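/- Let Λ = (λ_k)_{k≥1} be a lacunary sequence of positive reals with ∑_k 1/λ_k < ∞. Let φ : [0,1] → [0,1] be Borel measurable with ess sup_{[0,1]} φ = 1, with finite set of essential points of maximum 𝔐_φ = {x_1, …, x_k}, and φ(x_i) = 1 for each i. Assume that for each i: if x_i > 0 then liminf_{t→x_i⁻} (φ(x_i) − φ(t))/(x_i − t) = +∞, and if x_i < 1 then limsup_{t→x_i⁺} (φ(x_i) − φ(t))/(x_i − t) = −∞. Then C_φ : M²_Λ → L²([0,1]) is compact: it is bounded, and every sequence (g_n) in the linear span of the monomials x ↦ x^{λ_k} with ‖g_n‖_{L²} ≤ 1 admits a subsequence (g_{n_j}) such that (g_{n_j}∘φ) converges in L²([0,1]). -/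

import Mathlib

open MeasureTheory Filter

/-- Lebesgue measure restricted to the unit interval `[0,1]`. -/
noncomputable def m01 : Measure ℝ := volume.restrict (Set.Icc (0 : ℝ) 1)

/-- `g` belongs to the linear span of the monomials `x ↦ x^{Λ k}`. -/
def inSpan (Λ : ℕ → ℝ) (g : ℝ → ℝ) : Prop :=
  ∃ (n : ℕ) (c : Fin n → ℝ) (k : Fin n → ℕ),
    ∀ x : ℝ, g x = ∑ i, c i * x ^ (Λ (k i))

/-- The essential supremum of `φ` over the subset `s` of `[0,1]`, with respect to
Lebesgue measure, computed in `EReal`. -/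
noncomputable def essSupOn (φ : ℝ → ℝ) (s : Set ℝ) : EReal :=
  essSup (fun x => ((φ x : ℝ) : EReal)) (m01.restrict s)

/-- The set `𝔐_φ` of essential points of maximum of `φ`. -/
def essMaxPts (φ : ℝ → ℝ) : Set ℝ :=
  {x | x ∈ Set.Icc (0 : ℝ) 1 ∧
    ∀ E ∈ nhdsWithin x (Set.Icc (0 : ℝ) 1), essSupOn φ E = essSupOn φ Set.univ}


lemma sum_dist_le (r : ℝ) (hr0 : 0 ≤ r) (hr1 : r < 1) (s : Finset ℕ) (j : ℕ) :
    ∑ k ∈ s, r ^ ((j - k) + (k - j)) ≤ 2 / (1 - r) := by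
  have hs := summable_geometric_of_lt_one hr0 hr1
  have key : ∀ (t : Finset ℕ) (f : ℕ → ℕ), Set.InjOn f t → ∑ k ∈ t, r ^ f k ≤ 1 / (1 - r) := by
    intro t f hf
    rw [← Finset.sum_image (f := fun n => r ^ n) hf, one_div, ← tsum_geometric_of_lt_one hr0 hr1]
    exact hs.sum_le_tsum _ (fun i _ => pow_nonneg hr0 i)
  rw [← Finset.sum_filter_add_sum_filter_not s (fun k => k ≤ j)]
  have h1 := key (s.filter (fun k => k ≤ j)) (fun k => (j - k) + (k - j)) (by
    intro a ha b hb hab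
    simp at ha hb hab
    omega)
  have h2 := key (s.filter (fun k => ¬ k ≤ j)) (fun k => (j - k) + (k - j)) (by
    intro a ha b hb hab
    simp at ha hb hab
    omega)
  calc _ ≤ 1 / (1 - r) + 1 / (1 - r) := add_le_add h1 h2
    _ = _ := by ring

lemma lac_pow (μ : ℕ → ℝ) (q : ℝ) (hq : 1 < q) (hl : ∀ k, q * μ k ≤ μ (k + 1)) (j d : ℕ) :
    q ^ d * μ j ≤ μ (j + d) := by
  induction d with
  | zero => simp
  | succ d ih =>
    calc q ^ (d + 1) * μ j = q * (q ^ d * μ j) := by ring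
      _ ≤ q * μ (j + d) := by gcongr
      _ ≤ _ := hl _

lemma schur_term (μ : ℕ → ℝ) (hpos : ∀ k, 0 < μ k) (r : ℝ) (hr0 : 0 < r)
    (hl : ∀ j d, μ j ≤ (r ^ d) ^ 2 * μ (j + d)) (x y : ℝ) (j k : ℕ) :
    |x| * |y| / (μ j + μ k) ≤
      r ^ ((j - k) + (k - j)) * (x ^ 2 / μ j + y ^ 2 / μ k) := by
  wlog hjk : j ≤ k generalizing x y j k
  · have := this y x k j (by omega)
    rw [add_comm (k - j), add_comm (μ k), add_comm (y ^ 2 / μ k), mul_comm |y|] at this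
    exact this
  obtain ⟨d, rfl⟩ := Nat.exists_eq_add_of_le hjk
  have e : (j - (j + d)) + (j + d - j) = d := by omega
  rw [e]
  have h := hl j d
  set R := r ^ d with hR
  have hR0 : 0 < R := by positivity
  set a := μ j
  set b := μ (j + d)
  have ha : 0 < a := hpos j
  have hb : 0 < b := hpos _
  have h1 : |x| * |y| / (a + b) ≤ |x| * |y| / b := by
    gcongr; linarith
  have h2 : x ^ 2 / (R ^ 2 * b) ≤ x ^ 2 / a := by gcongr
  refine h1.trans (le_trans ?_ (mul_le_mul_of_nonneg_left (add_le_add_left h2 _) hR0.le))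
  have : R * (x ^ 2 / (R ^ 2 * b) + y ^ 2 / b) = (x ^ 2 / R + R * y ^ 2) / b := by
    field_simp
  rw [this]
  gcongr
  have h3 : x ^ 2 / R + R * y ^ 2 - |x| * |y| = ((|x| - R * |y|) ^ 2 + |x| * (R * |y|)) / R := by
    rw [← sq_abs x, ← sq_abs y]; field_simp; ring
  have : 0 ≤ ((|x| - R * |y|) ^ 2 + |x| * (R * |y|)) / R := by positivity
  linarith

lemma schur (μ : ℕ → ℝ) (hpos : ∀ k, 0 < μ k) (q : ℝ) (hq : 1 < q)
    (hl : ∀ k, q * μ k ≤ μ (k + 1)) :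
    ∃ K : ℝ, 0 < K ∧ ∀ (s : Finset ℕ) (c : ℕ → ℝ),
      ∑ j ∈ s, ∑ k ∈ s, |c j| * |c k| / (μ j + μ k) ≤ K * ∑ j ∈ s, c j ^ 2 / μ j := by
  set r := (Real.sqrt q)⁻¹ with hr
  have hsq : 1 < Real.sqrt q := by rw [Real.lt_sqrt] <;> linarith
  have hr0 : 0 < r := by positivity
  have hr1 : r < 1 := inv_lt_one_of_one_lt₀ hsq
  have hrq : r ^ 2 = q⁻¹ := by rw [hr, inv_pow, Real.sq_sqrt (by linarith)]
  have hl' : ∀ j d, μ j ≤ (r ^ d) ^ 2 * μ (j + d) := by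
    intro j d
    have := lac_pow μ q hq hl j d
    rw [← pow_mul, mul_comm d 2, pow_mul, hrq, inv_pow]
    rw [le_inv_mul_iff₀ (by positivity)]
    exact this
  have hr2 : 0 < 1 - r := by linarith
  refine ⟨4 / (1 - r), by positivity, fun s c => ?_⟩
  have hb := fun j => sum_dist_le r hr0.le hr1 s j
  calc ∑ j ∈ s, ∑ k ∈ s, |c j| * |c k| / (μ j + μ k)
      ≤ ∑ j ∈ s, ∑ k ∈ s, r ^ ((j - k) + (k - j)) * (c j ^ 2 / μ j + c k ^ 2 / μ k) :=
        Finset.sum_le_sum fun j _ => Finset.sum_le_sum fun k _ =>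
          schur_term μ hpos r hr0 hl' (c j) (c k) j k
    _ = ∑ j ∈ s, (∑ k ∈ s, r ^ ((j - k) + (k - j))) * (c j ^ 2 / μ j)
        + ∑ k ∈ s, (∑ j ∈ s, r ^ ((k - j) + (j - k))) * (c k ^ 2 / μ k) := by
        simp_rw [mul_add, Finset.sum_add_distrib, Finset.sum_mul]
        congr 1
        rw [Finset.sum_comm]
        refine Finset.sum_congr rfl fun k _ => Finset.sum_congr rfl fun j _ => ?_
        rw [add_comm (j - k)]
    _ ≤ ∑ j ∈ s, 2 / (1 - r) * (c j ^ 2 / μ j) + ∑ j ∈ s, 2 / (1 - r) * (c j ^ 2 / μ j) := by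
        have : ∀ j, 0 ≤ c j ^ 2 / μ j := fun j => by have := hpos j; positivity
        gcongr with j _ j _
        · exact this j
        · exact hb j
        · exact this j
        · exact hb j
    _ = _ := by rw [← Finset.mul_sum]; ring

lemma prod_bound (μ : ℕ → ℝ) (hpos : ∀ k, 0 < μ k) (q : ℝ) (hq : 1 < q)
    (hl : ∀ k, q * μ k ≤ μ (k + 1)) :
    ∃ A : ℝ, 0 < A ∧ ∀ (s : Finset ℕ) (j : ℕ),
      |∏ i ∈ s.erase j, (μ j + μ i) / (μ j - μ i)| ≤ A := by
  set t := q⁻¹ with ht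
  have ht0 : 0 < t := by positivity
  have ht1 : t < 1 := inv_lt_one_of_one_lt₀ hq
  have ht2 : 0 < 1 - t := by linarith
  have hl' : ∀ j d, μ j ≤ t ^ d * μ (j + d) := by
    intro j d
    rw [ht, inv_pow, le_inv_mul_iff₀ (by positivity)]
    exact lac_pow μ q hq hl j d
  have term : ∀ i j, i < j → (μ j + μ i) / |μ j - μ i| ≤ Real.exp (2 / (1 - t) * t ^ (j - i)) := by
    intro i j hij
    obtain ⟨d, rfl⟩ := Nat.exists_eq_add_of_lt hij
    have h := hl' i (d + 1)
    have e : i + d + 1 - i = d + 1 := by omega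
    rw [e]
    rw [← add_assoc] at h
    have hT : t ^ (d + 1) ≤ t := pow_le_of_le_one ht0.le ht1.le (by omega)
    have hT0 : 0 < t ^ (d + 1) := by positivity
    set T := t ^ (d + 1)
    set a := μ i
    set b := μ (i + d + 1)
    have ha : 0 < a := hpos _
    have hb : 0 < b := hpos _
    have hba : 0 < b - a := by nlinarith
    rw [abs_of_pos hba]
    refine le_trans ?_ (Real.add_one_le_exp _)
    rw [div_le_iff₀ hba]
    have : (1 - t) * b ≤ b - a := by nlinarith
    have h3 : 2 * a ≤ 2 / (1 - t) * T * (b - a) := by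
      calc 2 * a ≤ 2 * (T * b) := by linarith
        _ = 2 / (1 - t) * T * ((1 - t) * b) := by field_simp
        _ ≤ _ := by gcongr
    linarith
  refine ⟨Real.exp (2 / (1 - t) * (2 / (1 - t))), Real.exp_pos _, fun s j => ?_⟩
  rw [Finset.abs_prod]
  calc ∏ i ∈ s.erase j, |(μ j + μ i) / (μ j - μ i)|
      ≤ ∏ i ∈ s.erase j, Real.exp (2 / (1 - t) * t ^ ((j - i) + (i - j))) := by
        refine Finset.prod_le_prod (fun _ _ => abs_nonneg _) fun i hi => ?_
        have hne : i ≠ j := (Finset.mem_erase.1 hi).1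
        have h1 := hpos i
        have h2 := hpos j
        rw [abs_div, abs_of_pos (by linarith : 0 < μ j + μ i)]
        rcases lt_or_gt_of_ne hne with h | h
        · have := term i j h
          have e : i - j = 0 := by omega
          rw [e, add_zero]; exact this
        · have := term j i h
          have e : j - i = 0 := by omega
          rw [e, zero_add, abs_sub_comm, add_comm]; exact this
    _ = Real.exp (2 / (1 - t) * ∑ i ∈ s.erase j, t ^ ((j - i) + (i - j))) := by
        rw [← Real.exp_sum, Finset.mul_sum]
    _ ≤ _ := by
        gcongr
        exact sum_dist_le t ht0.le ht1 _ j

lemma cauchy_inv (μ : ℕ → ℝ) (hpos : ∀ k, 0 < μ k) (hinj : Function.Injective μ)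
    (s : Finset ℕ) (a : ℕ → ℝ)
    (ha : ∀ k, a k = 2 * μ k * ∏ i ∈ s.erase k, (μ k + μ i) / (μ k - μ i))
    (j l : ℕ) (hj : j ∈ s) (hl : l ∈ s) :
    ∑ k ∈ s, (1 / (μ j + μ k)) * (a k * a l / (μ k + μ l)) = if j = l then 1 else 0 := by
  have hpp : ∀ i k, μ i + μ k ≠ 0 := fun i k => by have := hpos i; have := hpos k; linarith
  have h := Lagrange.eq_interpolate (s := s) (v := μ) (f := Lagrange.nodal (s.erase j) (fun i => - μ i))
    hinj.injOn (by
      rw [Lagrange.degree_nodal]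
      exact_mod_cast Finset.card_erase_lt_of_mem hj)
  have h2 := congrArg (Polynomial.eval (-μ l)) h
  rw [Lagrange.eval_interpolate_not_at_node _ (by
    intro i _; have := hpos i; have := hpos l; linarith)] at h2
  simp only [Lagrange.eval_nodal, sub_neg_eq_add] at h2
  have hk : ∀ k ∈ s, Lagrange.nodalWeight s μ k * (-μ l - μ k)⁻¹ * ∏ i ∈ s.erase j, (μ k + μ i)
      = - ((1 / (μ j + μ k)) * (a k / (μ k + μ l))) := by
    intro k hk
    have e1 : a k / (μ j + μ k) = (∏ i ∈ s.erase k, (μ k - μ i)⁻¹) * ∏ i ∈ s.erase j, (μ k + μ i) := by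
      have e2 : (μ k + μ k) * ∏ i ∈ s.erase k, (μ k + μ i)
          = (μ k + μ j) * ∏ i ∈ s.erase j, (μ k + μ i) := by
        rw [Finset.mul_prod_erase s (fun i => μ k + μ i) hk, Finset.mul_prod_erase s (fun i => μ k + μ i) hj]
      rw [div_eq_iff (hpp _ _), ha, Finset.prod_div_distrib, Finset.prod_inv_distrib, div_eq_mul_inv]
      linear_combination (∏ i ∈ s.erase k, (μ k - μ i))⁻¹ * e2
    rw [Lagrange.nodalWeight]
    have e3 : (-μ l - μ k)⁻¹ = - (μ k + μ l)⁻¹ := by rw [← inv_neg]; congr 1; ring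
    rw [e3]
    rw [div_eq_mul_inv] at e1
    rw [one_div, div_eq_mul_inv (a k)]
    linear_combination (μ k + μ l)⁻¹ * e1
  rw [Finset.sum_congr rfl hk, Finset.sum_neg_distrib] at h2
  have hfac : ∑ k ∈ s, (1 / (μ j + μ k)) * (a k * a l / (μ k + μ l))
      = (∑ k ∈ s, (1 / (μ j + μ k)) * (a k / (μ k + μ l))) * a l := by
    rw [Finset.sum_mul]
    exact Finset.sum_congr rfl fun k _ => by ring
  rw [hfac]
  set S := ∑ k ∈ s, (1 / (μ j + μ k)) * (a k / (μ k + μ l))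
  split_ifs with hjl
  · subst hjl
    rw [← Finset.mul_prod_erase s _ hj] at h2
    have e4 : ∏ i ∈ s.erase j, (-μ j + μ i) = (-1) ^ (s.erase j).card * ∏ i ∈ s.erase j, (μ j - μ i) := by
      rw [← Finset.prod_const, ← Finset.prod_mul_distrib]
      exact Finset.prod_congr rfl fun i _ => by ring
    have e5 : ∏ i ∈ s.erase j, (-μ j - μ i) = (-1) ^ (s.erase j).card * ∏ i ∈ s.erase j, (μ j + μ i) := by
      rw [← Finset.prod_const, ← Finset.prod_mul_distrib]
      exact Finset.prod_congr rfl fun i _ => by ring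
    rw [e4, e5] at h2
    have hn : ((-1 : ℝ)) ^ (s.erase j).card ≠ 0 := pow_ne_zero _ (by norm_num)
    have hne : ∏ i ∈ s.erase j, (μ j - μ i) ≠ 0 := by
      rw [Finset.prod_ne_zero_iff]
      intro i hi
      rw [sub_ne_zero]
      exact fun h => (Finset.mem_erase.1 hi).1 (hinj h).symm
    have h3 : ∏ i ∈ s.erase j, (μ j - μ i) = 2 * μ j * (∏ i ∈ s.erase j, (μ j + μ i)) * S := by
      apply mul_left_cancel₀ hn
      rw [h2]; ring
    rw [ha, Finset.prod_div_distrib]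
    field_simp
    rw [h3]; ring
  · have e0 : ∏ i ∈ s.erase j, (-μ l + μ i) = 0 :=
      Finset.prod_eq_zero (Finset.mem_erase.2 ⟨fun h => hjl h.symm, hl⟩) (by ring)
    rw [e0] at h2
    have hne : ∏ i ∈ s, (-μ l - μ i) ≠ 0 := by
      rw [Finset.prod_ne_zero_iff]
      intro i _
      have := hpos i; have := hpos l
      linarith
    have : S = 0 := by
      rcases mul_eq_zero.1 h2.symm with h | h
      · exact absurd h hne
      · linarith
    rw [this, zero_mul]

lemma lower (μ : ℕ → ℝ) (hpos : ∀ k, 0 < μ k) (q : ℝ) (hq : 1 < q)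
    (hl : ∀ k, q * μ k ≤ μ (k + 1))
    (psd : ∀ (s : Finset ℕ) (c : ℕ → ℝ), 0 ≤ ∑ j ∈ s, ∑ k ∈ s, c j * c k * (1 / (μ j + μ k))) :
    ∃ K : ℝ, 0 < K ∧ ∀ (s : Finset ℕ) (c : ℕ → ℝ),
      ∑ j ∈ s, c j ^ 2 / μ j ≤ K * ∑ j ∈ s, ∑ k ∈ s, c j * c k * (1 / (μ j + μ k)) := by
  obtain ⟨K0, hK0, hS⟩ := schur μ hpos q hq hl
  obtain ⟨A, hA, hP⟩ := prod_bound μ hpos q hq hl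
  have hinj : Function.Injective μ := by
    apply StrictMono.injective
    apply strictMono_nat_of_lt_succ
    intro n
    have := hl n; have := hpos n
    nlinarith
  refine ⟨K0 * (4 * A ^ 2), by positivity, fun s c => ?_⟩
  set K := K0 * (4 * A ^ 2) with hK
  have hKpos : 0 < K := by positivity
  set a : ℕ → ℝ := fun k => 2 * μ k * ∏ i ∈ s.erase k, (μ k + μ i) / (μ k - μ i) with ha
  have hinv := cauchy_inv μ hpos hinj s a (fun k => rfl)
  set b : ℕ → ℝ := fun j => c j / μ j with hb
  set w : ℕ → ℝ := fun k => ∑ l ∈ s, a k * a l / (μ k + μ l) * b l with hw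
  have hGw : ∀ j ∈ s, ∑ k ∈ s, w k * (1 / (μ j + μ k)) = b j := by
    intro j hj
    calc ∑ k ∈ s, w k * (1 / (μ j + μ k))
        = ∑ l ∈ s, (∑ k ∈ s, (1 / (μ j + μ k)) * (a k * a l / (μ k + μ l))) * b l := by
          simp only [hw, Finset.sum_mul]
          rw [Finset.sum_comm]
          exact Finset.sum_congr rfl fun l _ => Finset.sum_congr rfl fun k _ => by ring
      _ = ∑ l ∈ s, (if j = l then 1 else 0) * b l :=
          Finset.sum_congr rfl fun l hl => by rw [hinv j l hj hl]
      _ = b j := by simp [hj]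
  set S := ∑ j ∈ s, c j ^ 2 / μ j with hSdef
  have hcb : ∑ j ∈ s, c j * b j = S := Finset.sum_congr rfl fun j _ => by simp only [hb]; ring
  have hwb : ∑ j ∈ s, w j * b j ≤ K * S := by
    calc ∑ j ∈ s, w j * b j = ∑ j ∈ s, ∑ l ∈ s, (a j * b j) * (a l * b l) / (μ j + μ l) := by
          simp only [hw, Finset.sum_mul]
          exact Finset.sum_congr rfl fun l _ => Finset.sum_congr rfl fun k _ => by ring
      _ ≤ ∑ j ∈ s, ∑ l ∈ s, |a j * b j| * |a l * b l| / (μ j + μ l) := by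
          refine Finset.sum_le_sum fun j _ => Finset.sum_le_sum fun l _ => ?_
          have := hpos j; have := hpos l
          rw [← abs_mul]
          gcongr
          exact le_abs_self _
      _ ≤ K0 * ∑ j ∈ s, (a j * b j) ^ 2 / μ j := hS s (fun j => a j * b j)
      _ ≤ K0 * ∑ j ∈ s, (4 * A ^ 2) * (c j ^ 2 / μ j) := by
          gcongr with j _
          have h1 := hP s j
          have h2 : (∏ i ∈ s.erase j, (μ j + μ i) / (μ j - μ i)) ^ 2 ≤ A ^ 2 :=
            sq_le_sq' (abs_le.1 h1).1 (abs_le.1 h1).2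
          have hj := hpos j
          have e : (a j * b j) ^ 2 / μ j
              = 4 * (∏ i ∈ s.erase j, (μ j + μ i) / (μ j - μ i)) ^ 2 * (c j ^ 2 / μ j) := by
            simp only [ha, hb]; field_simp; ring
          rw [e]
          gcongr
      _ = K * S := by rw [← Finset.mul_sum, hK]; ring
  set Q := ∑ j ∈ s, ∑ k ∈ s, c j * c k * (1 / (μ j + μ k)) with hQ
  have h0 := psd s (fun j => c j - K⁻¹ * w j)
  have hexp : ∑ j ∈ s, ∑ k ∈ s, (c j - K⁻¹ * w j) * (c k - K⁻¹ * w k) * (1 / (μ j + μ k))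
      = Q - 2 * K⁻¹ * S + K⁻¹ ^ 2 * ∑ j ∈ s, w j * b j := by
    have e1 : ∑ j ∈ s, ∑ k ∈ s, c j * w k * (1 / (μ j + μ k)) = S := by
      rw [← hcb]
      refine Finset.sum_congr rfl fun j hj => ?_
      rw [← hGw j hj, Finset.mul_sum]
      exact Finset.sum_congr rfl fun k _ => by ring
    have e2 : ∑ j ∈ s, ∑ k ∈ s, w j * c k * (1 / (μ j + μ k)) = S := by
      rw [← e1, Finset.sum_comm]
      exact Finset.sum_congr rfl fun j _ => Finset.sum_congr rfl fun k _ => by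
        rw [add_comm (μ k)]; ring
    have e3 : ∑ j ∈ s, ∑ k ∈ s, w j * w k * (1 / (μ j + μ k)) = ∑ j ∈ s, w j * b j := by
      refine Finset.sum_congr rfl fun j hj => ?_
      rw [← hGw j hj, Finset.mul_sum]
      exact Finset.sum_congr rfl fun k _ => by ring
    have : ∑ j ∈ s, ∑ k ∈ s, (c j - K⁻¹ * w j) * (c k - K⁻¹ * w k) * (1 / (μ j + μ k))
      = Q - K⁻¹ * (∑ j ∈ s, ∑ k ∈ s, c j * w k * (1 / (μ j + μ k)))
        - K⁻¹ * (∑ j ∈ s, ∑ k ∈ s, w j * c k * (1 / (μ j + μ k)))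
        + K⁻¹ ^ 2 * (∑ j ∈ s, ∑ k ∈ s, w j * w k * (1 / (μ j + μ k))) := by
      simp only [hQ, Finset.mul_sum, ← Finset.sum_sub_distrib, ← Finset.sum_add_distrib]
      exact Finset.sum_congr rfl fun j _ => Finset.sum_congr rfl fun k _ => by ring
    rw [this, e1, e2, e3]; ring
  rw [hexp] at h0
  have h1 : K⁻¹ ^ 2 * ∑ j ∈ s, w j * b j ≤ K⁻¹ ^ 2 * (K * S) := by gcongr
  have h2 : K⁻¹ ^ 2 * (K * S) = K⁻¹ * S := by field_simp
  have h3 : K⁻¹ * S ≤ Q := by linarith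
  rwa [inv_mul_le_iff₀ hKpos] at h3

lemma ae_cover (φ : ℝ → ℝ)
    (hsup : essSupOn φ Set.univ = (1 : EReal))
    (k : ℕ) (xs : Fin k → ℝ) (hM : essMaxPts φ = Set.range xs)
    (hone : ∀ i, φ (xs i) = 1)
    (hleft : ∀ i : Fin k, 0 < xs i → ∀ M : ℝ,
      ∀ᶠ t in nhdsWithin (xs i) (Set.Ico 0 (xs i)),
        M ≤ (φ (xs i) - φ t) / (xs i - t))
    (hright : ∀ i : Fin k, xs i < 1 → ∀ M : ℝ,
      ∀ᶠ t in nhdsWithin (xs i) (Set.Ioc (xs i) 1),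
        (φ (xs i) - φ t) / (xs i - t) ≤ M) (M : ℝ) :
    ∃ η : ℝ, 0 < η ∧ ∀ᵐ t ∂m01, η ≤ 1 - φ t ∨ ∃ i, M * |t - xs i| ≤ 1 - φ t := by
  have main : ∃ η : ℝ, 0 < η ∧ ∀ᵐ t ∂(volume : Measure ℝ), t ∈ Set.Icc (0:ℝ) 1 →
      (η ≤ 1 - φ t ∨ ∃ i, M * |t - xs i| ≤ 1 - φ t) := by
    refine IsCompact.induction_on (isCompact_Icc (a := (0:ℝ)) (b := 1)) (p := fun E =>
      ∃ η : ℝ, 0 < η ∧ ∀ᵐ t ∂(volume : Measure ℝ), t ∈ E →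
      (η ≤ 1 - φ t ∨ ∃ i, M * |t - xs i| ≤ 1 - φ t)) ?_ ?_ ?_ ?_
    · exact ⟨1, one_pos, by simp⟩
    · rintro s t hst ⟨η, h0, h⟩
      exact ⟨η, h0, h.mono fun x hx hs => hx (hst hs)⟩
    · rintro s t ⟨η, h0, h⟩ ⟨η', h0', h'⟩
      refine ⟨min η η', lt_min h0 h0', ?_⟩
      filter_upwards [h, h'] with x hx hx' hst
      rcases hst with hs | ht
      · rcases hx hs with h | h
        · exact Or.inl ((min_le_left _ _).trans h)
        · exact Or.inr h
      · rcases hx' ht with h | h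
        · exact Or.inl ((min_le_right _ _).trans h)
        · exact Or.inr h
    · intro x hx
      by_cases hxM : x ∈ essMaxPts φ
      · rw [hM] at hxM
        obtain ⟨i, rfl⟩ := hxM
        have hL : ∀ᶠ t in nhdsWithin (xs i) (Set.Ico 0 (xs i)), M * |t - xs i| ≤ 1 - φ t := by
          rcases hx.1.eq_or_lt with h0 | h0
          · rw [← h0]; simp
          · filter_upwards [hleft i h0 M, self_mem_nhdsWithin] with t ht htm
            have : 0 < xs i - t := by linarith [htm.2]
            rw [hone, le_div_iff₀ this] at ht
            rw [abs_sub_comm, abs_of_pos this]; exact ht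
        have hR : ∀ᶠ t in nhdsWithin (xs i) (Set.Ioc (xs i) 1), M * |t - xs i| ≤ 1 - φ t := by
          rcases hx.2.eq_or_lt with h0 | h0
          · rw [h0]; simp
          · filter_upwards [hright i h0 (-M), self_mem_nhdsWithin] with t ht htm
            have : xs i - t < 0 := by linarith [htm.1]
            rw [hone, div_le_iff_of_neg this] at ht
            rw [abs_sub_comm, abs_of_neg this]; linarith
        have hC : ∀ᶠ t in nhdsWithin (xs i) {xs i}, M * |t - xs i| ≤ 1 - φ t := by
          rw [nhdsWithin_singleton, eventually_pure]
          simp [hone]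
        have hall : ∀ᶠ t in nhdsWithin (xs i) (Set.Icc 0 1), M * |t - xs i| ≤ 1 - φ t := by
          have hsub : Set.Icc (0:ℝ) 1 ⊆ (Set.Ico 0 (xs i) ∪ {xs i}) ∪ Set.Ioc (xs i) 1 := by
            intro t ht
            rcases lt_trichotomy t (xs i) with h | h | h
            · exact Or.inl (Or.inl ⟨ht.1, h⟩)
            · exact Or.inl (Or.inr h)
            · exact Or.inr ⟨h, ht.2⟩
          refine Filter.Eventually.filter_mono (nhdsWithin_mono _ hsub) ?_
          rw [nhdsWithin_union, nhdsWithin_union, eventually_sup, eventually_sup]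
          exact ⟨⟨hL, hC⟩, hR⟩
        exact ⟨_, hall, 1, one_pos, Eventually.of_forall fun t ht => Or.inr ⟨i, ht⟩⟩
      · have : ∃ E ∈ nhdsWithin x (Set.Icc (0 : ℝ) 1), essSupOn φ E ≠ essSupOn φ Set.univ := by
          by_contra hcon
          push Not at hcon
          exact hxM ⟨hx, hcon⟩
        obtain ⟨E, hE, hne⟩ := this
        have hlt : essSupOn φ E < 1 := by
          rw [← hsup]
          refine lt_of_le_of_ne ?_ hne
          exact essSup_mono_measure' (Measure.restrict_mono (Set.subset_univ _) le_rfl)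
        obtain ⟨ρ, h1, h2⟩ := EReal.lt_iff_exists_real_btwn.1 hlt
        have hae := ae_lt_of_essSup_lt h1
        obtain ⟨U, hU, hxU, hUE⟩ := mem_nhdsWithin.1 hE
        have hae2 : ∀ᵐ t ∂(volume.restrict (U ∩ Set.Icc (0:ℝ) 1)), ((φ t : ℝ) : EReal) < ρ := by
          refine ae_mono ?_ hae
          rw [m01, ← Measure.restrict_restrict_of_subset (s := U ∩ Set.Icc (0:ℝ) 1) (t := Set.Icc 0 1) Set.inter_subset_right]
          exact Measure.restrict_mono hUE le_rfl
        rw [ae_restrict_iff' (hU.measurableSet.inter measurableSet_Icc)] at hae2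
        have hρ : ρ < 1 := by exact_mod_cast h2
        refine ⟨U ∩ Set.Icc 0 1, ?_, 1 - ρ, by linarith, ?_⟩
        · exact inter_mem (mem_nhdsWithin_of_mem_nhds (hU.mem_nhds hxU)) self_mem_nhdsWithin
        · filter_upwards [hae2] with t ht htU
          left
          have : φ t < ρ := by exact_mod_cast ht htU
          linarith
  obtain ⟨η, h0, h⟩ := main
  refine ⟨η, h0, ?_⟩
  rw [m01, ae_restrict_iff' measurableSet_Icc]
  exact h

lemma int_exp_abs (b x : ℝ) (hb : 0 < b) :
    Integrable (fun t : ℝ => Real.exp (-(b * |t - x|))) ∧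
    ∫ t, Real.exp (-(b * |t - x|)) = 2 / b := by
  have h2 : ∫ t, Real.exp (-(b * |t - x|)) = 2 / b := by
    rw [integral_sub_right_eq_self (fun t => Real.exp (-(b * |t|))) x,
      integral_comp_abs (f := fun t => Real.exp (-(b * t)))]
    have := integral_exp_mul_Ioi (a := -b) (by linarith) 0
    simp only [neg_mul] at this
    rw [this]; simp; field_simp
  refine ⟨?_, h2⟩
  by_contra hcon
  rw [integral_undef hcon] at h2
  have : 0 < 2 / b := by positivity
  linarith

lemma w_small (φ : ℝ → ℝ)
    (hmaps : Set.MapsTo φ (Set.Icc (0 : ℝ) 1) (Set.Icc (0 : ℝ) 1))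
    (k : ℕ) (xs : Fin k → ℝ)
    (hc : ∀ M : ℝ, ∃ η : ℝ, 0 < η ∧ ∀ᵐ t ∂m01, η ≤ 1 - φ t ∨ ∃ i, M * |t - xs i| ≤ 1 - φ t)
    (ε : ℝ) (hε : 0 < ε) :
    ∃ S : ℝ, 0 < S ∧ ∀ p, S ≤ p → ∫ t, φ t ^ p ∂m01 ≤ ε / p := by
  have : IsProbabilityMeasure m01 := ⟨by simp [m01]⟩
  set M : ℝ := 4 * (k + 1) / ε with hMdef
  have hM : 0 < M := by positivity
  obtain ⟨η, hη, hae⟩ := hc M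
  have hT := tendsto_rpow_mul_exp_neg_mul_atTop_nhds_zero 1 η hη
  simp only [Real.rpow_one] at hT
  have hT' : ∀ᶠ p : ℝ in atTop, p * Real.exp (-η * p) < ε / 2 :=
    hT.eventually (gt_mem_nhds (by positivity))
  obtain ⟨S, hS⟩ := eventually_atTop.1 hT'
  refine ⟨max S 1, by positivity, fun p hp => ?_⟩
  have hp0 : 0 < p := lt_of_lt_of_le one_pos ((le_max_right _ _).trans hp)
  have hpS := hS p ((le_max_left _ _).trans hp)
  have hmem : ∀ᵐ t ∂m01, t ∈ Set.Icc (0:ℝ) 1 := ae_restrict_mem measurableSet_Icc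
  have hpM : 0 < p * M := by positivity
  have hbd : ∀ᵐ t ∂m01, φ t ^ p ≤ Real.exp (-η * p) + ∑ i, Real.exp (-(p * M * |t - xs i|)) := by
    filter_upwards [hae, hmem] with t ht htI
    have hφ := hmaps htI
    have h1 : φ t ^ p ≤ Real.exp ((φ t - 1) * p) := by
      rw [Real.exp_mul]
      exact Real.rpow_le_rpow hφ.1 (by linarith [Real.add_one_le_exp (φ t - 1)]) hp0.le
    have hs0 : ∀ i ∈ Finset.univ, 0 ≤ Real.exp (-(p * M * |t - xs i|)) :=
      fun i _ => (Real.exp_pos _).le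
    rcases ht with h | ⟨i, h⟩
    · have h2 : Real.exp ((φ t - 1) * p) ≤ Real.exp (-η * p) := by
        gcongr; linarith
      linarith [Finset.sum_nonneg hs0]
    · have h2 : Real.exp ((φ t - 1) * p) ≤ Real.exp (-(p * M * |t - xs i|)) := by
        gcongr; nlinarith
      have h3 := Finset.single_le_sum hs0 (Finset.mem_univ i)
      linarith [Real.exp_pos (-η * p)]
  have hI : ∀ i, Integrable (fun t => Real.exp (-(p * M * |t - xs i|))) m01 := fun i =>
    (int_exp_abs (p * M) (xs i) hpM).1.restrict
  have hle : ∀ i, ∫ t, Real.exp (-(p * M * |t - xs i|)) ∂m01 ≤ 2 / (p * M) := by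
    intro i
    rw [← (int_exp_abs (p * M) (xs i) hpM).2]
    exact setIntegral_le_integral (int_exp_abs (p * M) (xs i) hpM).1
      (Eventually.of_forall fun t => (Real.exp_pos _).le)
  have hIs : Integrable (fun t => ∑ i, Real.exp (-(p * M * |t - xs i|))) m01 :=
    integrable_finsetSum _ fun i _ => hI i
  calc ∫ t, φ t ^ p ∂m01
      ≤ ∫ t, (Real.exp (-η * p) + ∑ i, Real.exp (-(p * M * |t - xs i|))) ∂m01 := by
        refine integral_mono_of_nonneg ?_ ((integrable_const _).add hIs) hbd
        filter_upwards [hmem] with t ht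
        exact Real.rpow_nonneg (hmaps ht).1 _
    _ = Real.exp (-η * p) + ∑ i, ∫ t, Real.exp (-(p * M * |t - xs i|)) ∂m01 := by
        rw [integral_add (integrable_const _) hIs, integral_finsetSum _ fun i _ => hI i]
        simp
    _ ≤ Real.exp (-η * p) + ∑ i : Fin k, 2 / (p * M) := by
        gcongr with i _
        exact hle i
    _ = Real.exp (-η * p) + k * (2 / (p * M)) := by simp
    _ ≤ (ε / 2) / p + (ε / 2) / p := by
        gcongr
        · rw [le_div_iff₀ hp0]; linarith
        · rw [hMdef]
          have : (k : ℝ) * (2 / (p * (4 * (k + 1) / ε))) = (ε / 2) / p * (k / (k + 1)) := by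
            field_simp; ring
          rw [this]
          apply mul_le_of_le_one_right (by positivity)
          rw [div_le_one (by positivity)]; linarith
    _ = ε / p := by ring

lemma m01_prob : IsProbabilityMeasure m01 := ⟨by simp [m01]⟩

lemma m01_mem : ∀ᵐ t ∂m01, t ∈ Set.Icc (0:ℝ) 1 := ae_restrict_mem measurableSet_Icc

lemma rpow_int (u : ℝ → ℝ) (hu : Measurable u)
    (hm : Set.MapsTo u (Set.Icc (0 : ℝ) 1) (Set.Icc (0 : ℝ) 1)) (p : ℝ) (hp : 0 ≤ p) :
    Integrable (fun t => u t ^ p) m01 := by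
  have := m01_prob
  refine Integrable.of_bound (hu.pow_const p).aestronglyMeasurable 1 ?_
  filter_upwards [m01_mem] with t ht
  rw [Real.norm_eq_abs, abs_of_nonneg (Real.rpow_nonneg (hm ht).1 _)]
  exact Real.rpow_le_one (hm ht).1 (hm ht).2 hp

lemma poly_memLp (Λ : ℕ → ℝ) (hpos : ∀ k, 0 < Λ k) (u : ℝ → ℝ) (hu : Measurable u)
    (hm : Set.MapsTo u (Set.Icc (0 : ℝ) 1) (Set.Icc (0 : ℝ) 1)) (s : Finset ℕ) (c : ℕ → ℝ) :
    MemLp (fun t => ∑ j ∈ s, c j * u t ^ Λ j) 2 m01 := by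
  have := m01_prob
  refine memLp_finsetSum s fun j _ => MemLp.const_mul ?_ (c j)
  refine MemLp.of_bound (hu.pow_const _).aestronglyMeasurable 1 ?_
  filter_upwards [m01_mem] with t ht
  rw [Real.norm_eq_abs, abs_of_nonneg (Real.rpow_nonneg (hm ht).1 _)]
  exact Real.rpow_le_one (hm ht).1 (hm ht).2 (hpos j).le

lemma quad_expand (Λ : ℕ → ℝ) (hpos : ∀ k, 0 < Λ k) (u : ℝ → ℝ) (hu : Measurable u)
    (hm : Set.MapsTo u (Set.Icc (0 : ℝ) 1) (Set.Icc (0 : ℝ) 1)) (s : Finset ℕ) (c : ℕ → ℝ) :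
    ∫ t, (∑ j ∈ s, c j * u t ^ Λ j) ^ 2 ∂m01
      = ∑ j ∈ s, ∑ k ∈ s, c j * c k * ∫ t, u t ^ (Λ j + Λ k) ∂m01 := by
  have hI : ∀ j k, Integrable (fun t => c j * c k * u t ^ (Λ j + Λ k)) m01 := fun j k =>
    (rpow_int u hu hm _ (by have := hpos j; have := hpos k; linarith)).const_mul _
  calc ∫ t, (∑ j ∈ s, c j * u t ^ Λ j) ^ 2 ∂m01
      = ∫ t, ∑ j ∈ s, ∑ k ∈ s, c j * c k * u t ^ (Λ j + Λ k) ∂m01 := by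
        refine integral_congr_ae ?_
        filter_upwards [m01_mem] with t ht
        rw [sq, Finset.sum_mul_sum]
        refine Finset.sum_congr rfl fun j _ => Finset.sum_congr rfl fun k _ => ?_
        rw [Real.rpow_add_of_nonneg (hm ht).1 (hpos j).le (hpos k).le]; ring
    _ = _ := by
        rw [integral_finsetSum _ fun j _ => integrable_finsetSum _ fun k _ => hI j k]
        refine Finset.sum_congr rfl fun j _ => ?_
        rw [integral_finsetSum _ fun k _ => hI j k]
        exact Finset.sum_congr rfl fun k _ => integral_const_mul _ _

lemma int_id (p : ℝ) (hp : 0 < p) : ∫ t, t ^ p ∂m01 = 1 / (p + 1) := by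
  rw [m01, integral_Icc_eq_integral_Ioc, ← intervalIntegral.integral_of_le zero_le_one,
    integral_rpow (Or.inl (by linarith))]
  rw [Real.one_rpow, Real.zero_rpow (by linarith)]; simp

lemma quad_id (Λ : ℕ → ℝ) (hpos : ∀ k, 0 < Λ k) (s : Finset ℕ) (c : ℕ → ℝ) :
    ∫ t, (∑ j ∈ s, c j * t ^ Λ j) ^ 2 ∂m01
      = ∑ j ∈ s, ∑ k ∈ s, c j * c k * (1 / ((Λ j + 1 / 2) + (Λ k + 1 / 2))) := by
  rw [quad_expand Λ hpos (fun t => t) measurable_id (fun _ h => h)]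
  refine Finset.sum_congr rfl fun j _ => Finset.sum_congr rfl fun k _ => ?_
  rw [int_id _ (by have := hpos j; have := hpos k; linarith)]
  congr 2; ring

/-- Lower Riesz bound for lacunary monomials. -/
lemma riesz_lower (Λ : ℕ → ℝ) (hpos : ∀ k, 0 < Λ k) (γ : ℝ) (hγ : 1 < γ)
    (hl : ∀ k, γ * Λ k ≤ Λ (k + 1)) :
    ∃ K : ℝ, 0 < K ∧ ∀ (s : Finset ℕ) (c : ℕ → ℝ),
      ∑ j ∈ s, c j ^ 2 / Λ j ≤ K * ∫ t, (∑ j ∈ s, c j * t ^ Λ j) ^ 2 ∂m01 := by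
  have h0 := hpos 0
  have hmono : ∀ k, Λ 0 ≤ Λ k := by
    intro k
    have := lac_pow Λ γ hγ hl 0 k
    have h1 : 1 ≤ γ ^ k := one_le_pow₀ hγ.le
    rw [zero_add] at this
    nlinarith
  set q : ℝ := 1 + (γ - 1) * (Λ 0 / (Λ 0 + 1 / 2)) with hq
  have hq1 : 1 < q := by
    have : 0 < (γ - 1) * (Λ 0 / (Λ 0 + 1 / 2)) := by
      have : 0 < γ - 1 := by linarith
      positivity
    linarith
  obtain ⟨K, hK, h⟩ := lower (fun k => Λ k + 1 / 2) (fun k => by have := hpos k; positivity) q hq1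
    (by
      intro k
      have h1 := hl k
      have h2 := hmono k
      have hk := hpos k
      have h3 : Λ 0 / (Λ 0 + 1 / 2) * (Λ k + 1 / 2) ≤ Λ k := by
        rw [div_mul_eq_mul_div, div_le_iff₀ (by positivity)]
        nlinarith
      have h4 : (γ - 1) * (Λ 0 / (Λ 0 + 1 / 2) * (Λ k + 1 / 2)) ≤ (γ - 1) * Λ k :=
        mul_le_mul_of_nonneg_left h3 (by linarith)
      simp only [hq]
      nlinarith)
    (by
      intro s c
      rw [← quad_id Λ hpos]
      exact integral_nonneg fun t => sq_nonneg _)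
  refine ⟨(1 + 1 / (2 * Λ 0)) * K, by positivity, fun s c => ?_⟩
  rw [quad_id Λ hpos, mul_assoc]
  refine le_trans ?_ (mul_le_mul_of_nonneg_left (h s c) (by positivity))
  rw [Finset.mul_sum]
  refine Finset.sum_le_sum fun j _ => ?_
  have hj := hpos j
  have hm := hmono j
  rw [← mul_div_assoc, div_le_div_iff₀ hj (by positivity)]
  have : Λ j + 1 / 2 ≤ (1 + 1 / (2 * Λ 0)) * Λ j := by
    have : 1 / (2 * Λ 0) * Λ j ≥ 1 / 2 := by
      rw [ge_iff_le, div_mul_eq_mul_div, le_div_iff₀ (by positivity)]; linarith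
    linarith
  nlinarith [mul_le_mul_of_nonneg_left this (sq_nonneg (c j))]

lemma comp_upper (Λ : ℕ → ℝ) (hpos : ∀ k, 0 < Λ k) (K : ℝ)
    (hK : ∀ (s : Finset ℕ) (c : ℕ → ℝ),
      ∑ j ∈ s, ∑ k ∈ s, |c j| * |c k| / (Λ j + Λ k) ≤ K * ∑ j ∈ s, c j ^ 2 / Λ j)
    (φ : ℝ → ℝ) (hu : Measurable φ)
    (hm : Set.MapsTo φ (Set.Icc (0 : ℝ) 1) (Set.Icc (0 : ℝ) 1)) (s : Finset ℕ) (c : ℕ → ℝ)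
    (δ : ℝ) (hδ : 0 ≤ δ)
    (hw : ∀ j ∈ s, ∀ k ∈ s, ∫ t, φ t ^ (Λ j + Λ k) ∂m01 ≤ δ / (Λ j + Λ k)) :
    ∫ t, (∑ j ∈ s, c j * φ t ^ Λ j) ^ 2 ∂m01 ≤ δ * K * ∑ j ∈ s, c j ^ 2 / Λ j := by
  rw [quad_expand Λ hpos φ hu hm, mul_assoc]
  refine le_trans ?_ (mul_le_mul_of_nonneg_left (hK s c) hδ)
  simp only [Finset.mul_sum]
  refine Finset.sum_le_sum fun j hj => Finset.sum_le_sum fun k hk => ?_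
  have h0 : 0 ≤ ∫ t, φ t ^ (Λ j + Λ k) ∂m01 := by
    refine integral_nonneg_of_ae ?_
    filter_upwards [m01_mem] with t ht
    exact Real.rpow_nonneg (hm ht).1 _
  calc c j * c k * ∫ t, φ t ^ (Λ j + Λ k) ∂m01
      ≤ (|c j| * |c k|) * ∫ t, φ t ^ (Λ j + Λ k) ∂m01 := by
        refine mul_le_mul_of_nonneg_right ?_ h0
        rw [← abs_mul]; exact le_abs_self _
    _ ≤ (|c j| * |c k|) * (δ / (Λ j + Λ k)) := by
        gcongr; exact hw j hj k hk
    _ = _ := by ring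

lemma span_repr (Λ : ℕ → ℝ) (g : ℝ → ℝ) (hg : inSpan Λ g) :
    ∃ (a : ℕ → ℝ) (N : ℕ), ∀ R, N ≤ R → ∀ x, g x = ∑ j ∈ Finset.range R, a j * x ^ Λ j := by
  obtain ⟨n, c, k, h⟩ := hg
  refine ⟨fun j => ∑ i with k i = j, c i, (Finset.univ.sup k) + 1, fun R hR x => ?_⟩
  rw [h x, ← Finset.sum_fiberwise_of_maps_to (s := Finset.univ) (t := Finset.range R) (g := k)]
  · refine Finset.sum_congr rfl fun j _ => ?_
    rw [Finset.sum_mul]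
    refine Finset.sum_congr rfl fun i hi => ?_
    rw [(Finset.mem_filter.1 hi).2]
  · intro i _
    have : k i ≤ Finset.univ.sup k := Finset.le_sup (Finset.mem_univ i)
    exact Finset.mem_range.2 (by omega)

lemma l2_norm (f : ℝ → ℝ) (hf : MemLp f 2 m01) :
    eLpNorm f 2 m01 = ENNReal.ofReal (Real.sqrt (∫ t, f t ^ 2 ∂m01)) := by
  rw [hf.eLpNorm_eq_integral_rpow_norm (by norm_num) (by norm_num)]
  rw [Real.sqrt_eq_rpow]
  simp
/-- Let `Λ` be lacunary with `∑ 1/λ_k < ∞` and `φ : [0,1] → [0,1]`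
Borel measurable with `ess sup φ = 1` and finitely many essential points of maximum
`x_1, …, x_k`, with `φ(x_i) = 1`. If at each `x_i` the lower left Dini derivative is `+∞`
(when `x_i > 0`) and the upper right Dini derivative is `−∞` (when `x_i < 1`), then
`C_φ : M²_Λ → L²([0,1])` is compact: it is bounded, and every bounded sequence in the
span of the monomials has a subsequence whose composition with `φ` converges in `L²`. -/
theorem composition_operator_compact
    (Λ : ℕ → ℝ) (hpos : ∀ k, 0 < Λ k)
    (hlac : ∃ γ : ℝ, 1 < γ ∧ ∀ k, γ * Λ k ≤ Λ (k + 1))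
    (hsum : Summable fun k => 1 / Λ k)
    (φ : ℝ → ℝ) (hmeas : Measurable φ)
    (hmaps : Set.MapsTo φ (Set.Icc (0 : ℝ) 1) (Set.Icc (0 : ℝ) 1))
    (hsup : essSupOn φ Set.univ = (1 : EReal))
    (k : ℕ) (xs : Fin k → ℝ) (hM : essMaxPts φ = Set.range xs)
    (hone : ∀ i, φ (xs i) = 1)
    (hleft : ∀ i : Fin k, 0 < xs i → ∀ M : ℝ,
      ∀ᶠ t in nhdsWithin (xs i) (Set.Ico 0 (xs i)),
        M ≤ (φ (xs i) - φ t) / (xs i - t))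
    (hright : ∀ i : Fin k, xs i < 1 → ∀ M : ℝ,
      ∀ᶠ t in nhdsWithin (xs i) (Set.Ioc (xs i) 1),
        (φ (xs i) - φ t) / (xs i - t) ≤ M) :
    (∃ C : ℝ, 0 < C ∧ ∀ g : ℝ → ℝ, inSpan Λ g →
      (∫ x in Set.Icc (0 : ℝ) 1, |g (φ x)| ^ 2) ≤
        C ^ 2 * ∫ x in Set.Icc (0 : ℝ) 1, |g x| ^ 2) ∧
    (∀ g : ℕ → ℝ → ℝ, (∀ n, inSpan Λ (g n)) →
      (∀ n, eLpNorm (g n) 2 m01 ≤ 1) →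
      ∃ σ : ℕ → ℕ, StrictMono σ ∧ ∃ h : ℝ → ℝ, MemLp h 2 m01 ∧
        Tendsto (fun j => eLpNorm (fun x => g (σ j) (φ x) - h x) 2 m01)
          atTop (nhds 0)) := by
  obtain ⟨γ, hγ, hl⟩ := hlac
  have := m01_prob
  have hcov := ae_cover φ hsup k xs hM hone hleft hright
  have hws := w_small φ hmaps k xs hcov
  obtain ⟨K0, hK0, hS⟩ := schur Λ hpos γ hγ hl
  obtain ⟨K, hK, hR⟩ := riesz_lower Λ hpos γ hγ hl
  -- global bound on the moments
  obtain ⟨W, hW, hWb⟩ : ∃ W : ℝ, 0 < W ∧ ∀ p, 0 < p → ∫ t, φ t ^ p ∂m01 ≤ W / p := by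
    obtain ⟨S, hS0, hS1⟩ := hws 1 one_pos
    refine ⟨max S 1, by positivity, fun p hp => ?_⟩
    rcases le_total S p with h | h
    · refine (hS1 p h).trans ?_
      gcongr
      exact le_max_right _ _
    · have h1 : ∫ t, φ t ^ p ∂m01 ≤ ∫ t, (1 : ℝ) ∂m01 := by
        refine integral_mono_ae (rpow_int φ hmeas hmaps p hp.le) (integrable_const _) ?_
        filter_upwards [m01_mem] with t ht
        exact Real.rpow_le_one (hmaps ht).1 (hmaps ht).2 hp.le
      simp only [integral_const, probReal_univ, smul_eq_mul, mul_one] at h1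
      refine h1.trans ?_
      rw [le_div_iff₀ hp, one_mul]
      exact h.trans (le_max_left _ _)
  have hadd : ∀ i j, 0 < Λ i + Λ j := fun i j => add_pos (hpos i) (hpos j)
  have hup : ∀ (s : Finset ℕ) (c : ℕ → ℝ),
      ∫ t, (∑ j ∈ s, c j * φ t ^ Λ j) ^ 2 ∂m01 ≤ W * K0 * ∑ j ∈ s, c j ^ 2 / Λ j := fun s c =>
    comp_upper Λ hpos K0 hS φ hmeas hmaps s c W hW.le fun i _ j _ => hWb _ (hadd i j)
  have htop : Tendsto Λ atTop atTop := by
    have h1 : Tendsto (fun n : ℕ => γ ^ n * Λ 0) atTop atTop :=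
      (tendsto_pow_atTop_atTop_of_one_lt hγ).atTop_mul_const (hpos 0)
    refine tendsto_atTop_mono (fun n => ?_) h1
    have := lac_pow Λ γ hγ hl 0 n
    rwa [zero_add] at this
  have htail : ∀ δ : ℝ, 0 < δ → ∃ N : ℕ, ∀ (R : ℕ) (c : ℕ → ℝ),
      ∫ t, (∑ j ∈ Finset.Ico N R, c j * φ t ^ Λ j) ^ 2 ∂m01
        ≤ δ * K0 * ∑ j ∈ Finset.Ico N R, c j ^ 2 / Λ j := by
    intro δ hδ
    obtain ⟨S, hS0, hS1⟩ := hws δ hδ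
    obtain ⟨N, hN⟩ := eventually_atTop.1 (htop.eventually_ge_atTop S)
    refine ⟨N, fun R c => comp_upper Λ hpos K0 hS φ hmeas hmaps _ c δ hδ.le fun i hi j hj => ?_⟩
    refine hS1 _ ?_
    have := hN i (Finset.mem_Ico.1 hi).1
    have := hpos j
    linarith
  constructor
  · refine ⟨W * K0 * K + 1, by positivity, fun g hg => ?_⟩
    obtain ⟨a, N, ha⟩ := span_repr Λ g hg
    have ha' := ha N le_rfl
    simp only [sq_abs]
    have e1 : ∫ x in Set.Icc (0 : ℝ) 1, g (φ x) ^ 2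
        = ∫ t, (∑ j ∈ Finset.range N, a j * φ t ^ Λ j) ^ 2 ∂m01 := by
      simp only [ha']; rfl
    have e2 : ∫ x in Set.Icc (0 : ℝ) 1, g x ^ 2
        = ∫ t, (∑ j ∈ Finset.range N, a j * t ^ Λ j) ^ 2 ∂m01 := by
      simp only [ha']; rfl
    rw [e1, e2]
    have hI : 0 ≤ ∫ t, (∑ j ∈ Finset.range N, a j * t ^ Λ j) ^ 2 ∂m01 :=
      integral_nonneg fun t => sq_nonneg _
    calc _ ≤ W * K0 * ∑ j ∈ Finset.range N, a j ^ 2 / Λ j := hup _ a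
      _ ≤ W * K0 * (K * ∫ t, (∑ j ∈ Finset.range N, a j * t ^ Λ j) ^ 2 ∂m01) := by
          gcongr
          exact hR _ a
      _ = W * K0 * K * ∫ t, (∑ j ∈ Finset.range N, a j * t ^ Λ j) ^ 2 ∂m01 := by ring
      _ ≤ _ := by
          gcongr
          have : 0 < W * K0 * K := by positivity
          nlinarith
  · intro g hg hg1
    choose a N ha using fun n => span_repr Λ (g n) (hg n)
    -- energy bound
    have hE : ∀ n R, ∑ j ∈ Finset.range R, a n j ^ 2 / Λ j ≤ K := by
      intro n R
      have hR1 := hR (Finset.range (max R (N n))) (a n)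
      have hrep := ha n (max R (N n)) (le_max_right _ _)
      have hmem := poly_memLp Λ hpos (fun t => t) measurable_id (fun _ h => h)
        (Finset.range (max R (N n))) (a n)
      have hn := l2_norm _ hmem
      have hfe : g n = fun t => ∑ j ∈ Finset.range (max R (N n)), a n j * t ^ Λ j := funext hrep
      have h1 := hg1 n
      rw [hfe, hn, ENNReal.ofReal_le_one, Real.sqrt_le_one] at h1
      calc ∑ j ∈ Finset.range R, a n j ^ 2 / Λ j
          ≤ ∑ j ∈ Finset.range (max R (N n)), a n j ^ 2 / Λ j := by
            refine Finset.sum_le_sum_of_subset_of_nonneg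
              (Finset.range_subset_range.2 (le_max_left _ _)) fun j _ _ => ?_
            have := hpos j
            positivity
        _ ≤ K * 1 := hR1.trans (by gcongr)
        _ = K := mul_one K
    -- coefficients live in a compact set
    have hcoef : ∀ n, a n ∈ Set.pi Set.univ
        (fun j => Set.Icc (-Real.sqrt (K * Λ j)) (Real.sqrt (K * Λ j))) := by
      intro n j _
      have hj := hpos j
      have h1 : a n j ^ 2 / Λ j ≤ K := by
        refine le_trans ?_ (hE n (j + 1))
        refine Finset.single_le_sum (f := fun j => a n j ^ 2 / Λ j) (fun i _ => ?_)
          (Finset.self_mem_range_succ j)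
        have := hpos i
        positivity
      rw [div_le_iff₀ hj] at h1
      exact abs_le.1 (Real.abs_le_sqrt h1)
    obtain ⟨α, -, σ, hσ, hlim⟩ :=
      (isCompact_univ_pi fun j => isCompact_Icc).tendsto_subseq hcoef
    rw [tendsto_pi_nhds] at hlim
    refine ⟨σ, hσ, ?_⟩
    have hrepφ : ∀ n R, N n ≤ R →
        (fun x => g n (φ x)) = fun t => ∑ j ∈ Finset.range R, a n j * φ t ^ Λ j :=
      fun n R h => funext fun x => ha n R h (φ x)
    have hmem : ∀ n, MemLp (fun x => g (σ n) (φ x)) 2 m01 := by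
      intro n
      rw [hrepφ (σ n) _ le_rfl]
      exact poly_memLp Λ hpos φ hmeas hmaps _ _
    have hdist : ∀ n m, dist ((hmem n).toLp _) ((hmem m).toLp _)
        = Real.sqrt (∫ t, (g (σ n) (φ t) - g (σ m) (φ t)) ^ 2 ∂m01) := by
      intro n m
      rw [dist_eq_norm, ← MemLp.toLp_sub, Lp.norm_toLp, l2_norm _ ((hmem n).sub (hmem m)),
        ENNReal.toReal_ofReal (Real.sqrt_nonneg _)]
      rfl
    have hcauchy : CauchySeq (fun n => (hmem n).toLp (fun x => g (σ n) (φ x))) := by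
      rw [Metric.cauchySeq_iff]
      intro ε hε
      set δ : ℝ := ε ^ 2 / (32 * K0 * K) with hδdef
      have hδ : 0 < δ := by positivity
      obtain ⟨N0, hN0⟩ := htail δ hδ
      have hT : Tendsto (fun p : ℕ × ℕ => ∑ j ∈ Finset.range N0,
          (a (σ p.1) j - a (σ p.2) j) ^ 2 / Λ j) atTop (nhds 0) := by
        have h1 : ∀ j ∈ Finset.range N0, Tendsto (fun p : ℕ × ℕ =>
            (a (σ p.1) j - a (σ p.2) j) ^ 2 / Λ j) atTop (nhds ((α j - α j) ^ 2 / Λ j)) := by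
          intro j _
          rw [← prod_atTop_atTop_eq]
          have hf : Tendsto (fun p : ℕ × ℕ => a (σ p.1) j) (atTop ×ˢ atTop) (nhds (α j)) :=
            (hlim j).comp tendsto_fst
          have hs : Tendsto (fun p : ℕ × ℕ => a (σ p.2) j) (atTop ×ˢ atTop) (nhds (α j)) :=
            (hlim j).comp tendsto_snd
          exact ((hf.sub hs).pow 2).div_const _
        have h2 := tendsto_finsetSum (Finset.range N0) h1
        simpa using h2
      have hev := hT.eventually (gt_mem_nhds (show (0:ℝ) < ε ^ 2 / (4 * (W * K0)) by positivity))
      obtain ⟨n0, hn0⟩ := eventually_atTop_prod_self.1 hev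
      refine ⟨n0, fun n hn m hm => ?_⟩
      rw [hdist, Real.sqrt_lt' hε]
      set R := max N0 (max (N (σ n)) (N (σ m))) with hRdef
      set b : ℕ → ℝ := fun j => a (σ n) j - a (σ m) j with hb
      have hsplit : ∀ t, g (σ n) (φ t) - g (σ m) (φ t)
          = (∑ j ∈ Finset.range N0, b j * φ t ^ Λ j)
            + ∑ j ∈ Finset.Ico N0 R, b j * φ t ^ Λ j := by
        intro t
        rw [ha (σ n) R (by simp [hRdef]) (φ t), ha (σ m) R (by simp [hRdef]) (φ t),
          Finset.sum_range_add_sum_Ico _ (le_max_left _ _), ← Finset.sum_sub_distrib]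
        exact Finset.sum_congr rfl fun j _ => by simp only [hb]; ring
      have hi1 := (poly_memLp Λ hpos φ hmeas hmaps (Finset.range N0) b).integrable_sq
      have hi2 := (poly_memLp Λ hpos φ hmeas hmaps (Finset.Ico N0 R) b).integrable_sq
      have hb1 := hup (Finset.range N0) b
      have hb2 := hN0 R b
      have hlt := hn0 n m hn hm
      have hEb : ∑ j ∈ Finset.Ico N0 R, b j ^ 2 / Λ j ≤ 4 * K := by
        calc ∑ j ∈ Finset.Ico N0 R, b j ^ 2 / Λ j
            ≤ ∑ j ∈ Finset.range R, b j ^ 2 / Λ j := by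
              refine Finset.sum_le_sum_of_subset_of_nonneg ?_ fun j _ _ => ?_
              · intro j hj
                exact Finset.mem_range.2 (Finset.mem_Ico.1 hj).2
              · have := hpos j
                positivity
          _ ≤ ∑ j ∈ Finset.range R, (2 * (a (σ n) j ^ 2 / Λ j) + 2 * (a (σ m) j ^ 2 / Λ j)) := by
              refine Finset.sum_le_sum fun j _ => ?_
              have := hpos j
              rw [← mul_div_assoc, ← mul_div_assoc, ← add_div]
              gcongr
              simp only [hb]
              nlinarith [sq_nonneg (a (σ n) j + a (σ m) j)]
          _ ≤ 4 * K := by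
              rw [Finset.sum_add_distrib, ← Finset.mul_sum, ← Finset.mul_sum]
              linarith [hE (σ n) R, hE (σ m) R]
      calc ∫ t, (g (σ n) (φ t) - g (σ m) (φ t)) ^ 2 ∂m01
          ≤ ∫ t, (2 * (∑ j ∈ Finset.range N0, b j * φ t ^ Λ j) ^ 2
            + 2 * (∑ j ∈ Finset.Ico N0 R, b j * φ t ^ Λ j) ^ 2) ∂m01 := by
            refine integral_mono_of_nonneg (Eventually.of_forall fun t => sq_nonneg _)
              ((hi1.const_mul 2).add (hi2.const_mul 2)) (Eventually.of_forall fun t => ?_)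
            simp only [hsplit]
            nlinarith [sq_nonneg ((∑ j ∈ Finset.range N0, b j * φ t ^ Λ j)
              - ∑ j ∈ Finset.Ico N0 R, b j * φ t ^ Λ j)]
        _ = 2 * (∫ t, (∑ j ∈ Finset.range N0, b j * φ t ^ Λ j) ^ 2 ∂m01)
            + 2 * ∫ t, (∑ j ∈ Finset.Ico N0 R, b j * φ t ^ Λ j) ^ 2 ∂m01 := by
            rw [integral_add (hi1.const_mul 2) (hi2.const_mul 2), integral_const_mul,
              integral_const_mul]
        _ ≤ 2 * (W * K0 * ∑ j ∈ Finset.range N0, b j ^ 2 / Λ j) + 2 * (δ * K0 * (4 * K)) := by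
            refine add_le_add (mul_le_mul_of_nonneg_left hb1 (by norm_num))
              (mul_le_mul_of_nonneg_left (hb2.trans ?_) (by norm_num))
            gcongr
        _ < 2 * (W * K0 * (ε ^ 2 / (4 * (W * K0)))) + 2 * (δ * K0 * (4 * K)) := by
            gcongr
        _ = ε ^ 2 / 2 + ε ^ 2 / 4 := by
            rw [hδdef]; field_simp; norm_num
        _ < ε ^ 2 := by
            have : 0 < ε ^ 2 := by positivity
            linarith
    obtain ⟨F, hF⟩ := cauchySeq_tendsto_of_complete hcauchy
    refine ⟨F, Lp.memLp F, ?_⟩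
    have h1 := (Lp.tendsto_Lp_iff_tendsto_eLpNorm'' (fun n x => g (σ n) (φ x)) hmem F
      (Lp.memLp F)).1 (by rw [Lp.toLp_coeFn]; exact hF)
    exact h1
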